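/- Fix k ≥ 0 and α ∈ ℝ, and let F₂(x,v) = −kxv²/(1 + kx²) − α²x/(1 + kx²)³. Then μ₂(x,v) = k(1 + kx²)²v² − α² satisfies the Jacobi multiplier equation for the second nonlinear oscillator: for all (x,v) ∈ ℝ², v·∂μ₂/∂x(x,v) + ∂(μ₂F₂)/∂v(x,v) = 0. -/

import Mathlib

/-- `μ₂(x,v) = k(1+kx²)²v² − α²` satisfies the Jacobi multiplier
equation for the second nonlinear oscillator `ẍ = F₂(x,ẋ)`,
`F₂(x,v) = −kxv²/(1+kx²) − α²x/(1+kx²)³`, `k ≥ 0`. -/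
theorem jacobi_multiplier_mu2_second_oscillator
    (k α : ℝ) (hk : 0 ≤ k) (F₂ μ₂ : ℝ → ℝ → ℝ)
    (hF : ∀ x v : ℝ, F₂ x v =
      -(k * x * v ^ 2 / (1 + k * x ^ 2)) - α ^ 2 * x / (1 + k * x ^ 2) ^ 3)
    (hμ : ∀ x v : ℝ, μ₂ x v = k * (1 + k * x ^ 2) ^ 2 * v ^ 2 - α ^ 2) :
    ∀ x v : ℝ,
      v * deriv (fun x' => μ₂ x' v) x + deriv (fun v' => μ₂ x v' * F₂ x v') v = 0 := by
  intro x v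
  have hu : 1 + k * x ^ 2 ≠ 0 := by positivity
  have hprod : (fun v' => μ₂ x v' * F₂ x v') = fun v' =>
      -(k ^ 2 * x * (1 + k * x ^ 2)) * v' ^ 4 + α ^ 4 * x / (1 + k * x ^ 2) ^ 3 := by
    funext v'
    rw [hF, hμ]
    field_simp
    ring
  have hx : HasDerivAt (fun x' => μ₂ x' v) (4 * k ^ 2 * x * (1 + k * x ^ 2) * v ^ 2) x := by
    simp only [hμ]
    have h := ((((((hasDerivAt_id x).pow 2).const_mul k).const_add 1).pow 2).const_mul k
      |>.mul_const (v ^ 2)).sub_const (α ^ 2)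
    refine h.congr_deriv ?_
    simp only [Pi.pow_apply, id_eq, Nat.cast_ofNat]
    ring
  have hv : HasDerivAt (fun v' => μ₂ x v' * F₂ x v')
      (-(k ^ 2 * x * (1 + k * x ^ 2)) * (4 * v ^ 3)) v := by
    rw [hprod]
    simpa using ((hasDerivAt_pow 4 v).const_mul
      (-(k ^ 2 * x * (1 + k * x ^ 2)))).add_const (α ^ 4 * x / (1 + k * x ^ 2) ^ 3)
  rw [hx.deriv, hv.deriv]
  ring
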